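/- Let V be a nonlocal vertex algebra and U a generating subset. For n ≥ 0 define Eₙ^U = span{ u⁽¹⁾_{m₁}⋯u⁽ʳ⁾_{m_r}1 : 0 ≤ r ≤ n, u⁽ⁱ⁾ ∈ U, m_i ∈ ℤ }. Then (Eₙ^U) is an increasing filtration of V satisfying aₖEₙ^U ⊆ E_{m+n}^U for all a ∈ Eₘ^U, k ∈ ℤ. -/

import Mathlib

noncomputable section

open scoped TensorProduct


variable {V : Type} [AddCommGroup V] [Module ℂ V]

/-- A nonlocal vertex algebra on the `ℂ`-vector space `V`, presented via its mode maps: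
`Y n u` is the coefficient `uₙ` of `x^{-n-1}` in the vertex operator `Y(u,x)`.
The axioms are: truncation (`Y(u,x)v ∈ V((x))`), the vacuum property `Y(1,x)v = v`,
the creation property (`Y(u,x)1 ∈ V[[x]]` with constant term `u`), and weak
associativity: for all `u,v,w` there is `l ∈ ℕ` with
`(x₀+x₂)^l Y(u,x₀+x₂)Y(v,x₂)w = (x₀+x₂)^l Y(Y(u,x₀)v,x₂)w`, written out
coefficientwise (at `x₀^{-p-1} x₂^{-q-1}`, with generalized binomial coefficients). -/
structure NLVA (V : Type) [AddCommGroup V] [Module ℂ V] where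
  Y : ℤ → V →ₗ[ℂ] V →ₗ[ℂ] V
  vac : V
  trunc : ∀ u v : V, ∃ N : ℤ, ∀ n : ℤ, N ≤ n → Y n u v = 0
  vacuum_left : ∀ (n : ℤ) (v : V), Y n vac v = if n = -1 then v else 0
  creation : ∀ (u : V) (n : ℤ), 0 ≤ n → Y n u vac = 0
  creation_const : ∀ u : V, Y (-1) u vac = u
  weak_assoc : ∀ u v w : V, ∃ l : ℕ, ∀ p q : ℤ,
    (∑ᶠ j : ℕ, ((-1 : ℤ) ^ j * Ring.choose p j) •
        Y ((l : ℤ) + p - j) u (Y (q + j) v w)) =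
      ∑ i ∈ Finset.range (l + 1), (l.choose i : ℤ) • Y (q + l - i) (Y ((p : ℤ) + i) u v) w

/-- The multilinear map `(u₁, …, uₙ) ↦` (coefficient at `x₁^{m₁} ⋯ xₙ^{mₙ}` of
`Y(u₁,x₁) ⋯ Y(uₙ,xₙ)`, as an endomorphism of `V`). -/
def modeEndML (A : NLVA V) : (n : ℕ) → (Fin n → ℤ) →
    MultilinearMap ℂ (fun _ : Fin n => V) (V →ₗ[ℂ] V)
  | 0, _ => MultilinearMap.constOfIsEmpty ℂ _ LinearMap.id
  | n + 1, m =>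
      LinearMap.uncurryLeft
        { toFun := fun v =>
            (LinearMap.llcomp ℂ V V V (A.Y (-(m 0) - 1) v)).compMultilinearMap
              (modeEndML A n (Fin.tail m))
          map_add' := by intro v₁ v₂; ext u w; simp
          map_smul' := by intro c v; ext u w; simp }

/-- The predicate on `f : ℤⁿ → ℂ` expressing membership in the iterated Laurent series
field `ℂ((x₁))⋯((xₙ))` (coefficients truncated from below, iteratively; the head
coordinate is the outermost variable). -/
def IsIterLaurent : (n : ℕ) → ((Fin n → ℤ) → ℂ) → Prop
  | 0, _ => True
  | n + 1, f =>
      (∃ N : ℤ, ∀ k : ℤ, k < N → ∀ rest : Fin n → ℤ, f (Fin.cons k rest) = 0) ∧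
      ∀ k : ℤ, IsIterLaurent n (fun rest => f (Fin.cons k rest))

/-- The coefficient at `x₁^{m₁} ⋯ xₙ^{mₙ}` of `Y(·,x₁) ⋯ Y(·,xₙ)1`, as a linear
function of `u₁ ⊗ ⋯ ⊗ uₙ ∈ V^{⊗n}`. -/
def Zcoeff (A : NLVA V) (n : ℕ) (m : Fin n → ℤ) (w : ⨂[ℂ] (_ : Fin n), V) : V :=
  PiTensorProduct.lift (modeEndML A n m) w A.vac

/-- Injectivity of the Etingof–Kazhdan map
`Zₙ : V^{⊗n} ⊗ ℂ((x₁))⋯((xₙ)) → V((x₁))⋯((xₙ))`,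
`u₁ ⊗ ⋯ ⊗ uₙ ⊗ f ↦ f·Y(u₁,x₁)⋯Y(uₙ,xₙ)1`, phrased via families: writing an element of
the domain as `∑ₛ wₛ ⊗ fₛ` with `fₛ ∈ ℂ((x₁))⋯((xₙ))` linearly independent over `ℂ` and
`wₛ ∈ V^{⊗n}`, its image (whose coefficient at `m` is the convolution
`∑ₛ ∑_j fₛ(j) · (Y⋯Y1)(m-j)`) vanishes only if all `wₛ = 0`. -/
def ZInjective (A : NLVA V) (n : ℕ) : Prop :=
  ∀ (r : ℕ) (f : Fin r → ((Fin n → ℤ) → ℂ)),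
    (∀ s, IsIterLaurent n (f s)) → LinearIndependent ℂ f →
    ∀ w : Fin r → (⨂[ℂ] (_ : Fin n), V),
      (∀ m : Fin n → ℤ,
        (∑ s, ∑ᶠ j : Fin n → ℤ, f s j • Zcoeff A n (fun i => m i - j i) (w s)) = 0) →
      ∀ s, w s = 0

/-- A nonlocal vertex algebra is nondegenerate if `Zₙ` is injective for every `n ≥ 1`. -/
def Nondegenerate (A : NLVA V) : Prop := ∀ n : ℕ, 1 ≤ n → ZInjective A n

/-- The iterated product `u⁽¹⁾_{m₁} ⋯ u⁽ʳ⁾_{m_r} 1` of modes applied to the vacuum. -/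
def modeSeqV (A : NLVA V) : (r : ℕ) → (Fin r → V) → (Fin r → ℤ) → V
  | 0, _, _ => A.vac
  | r + 1, u, m => A.Y (m 0) (u 0) (modeSeqV A r (Fin.tail u) (Fin.tail m))

/-- `Eₙ^U = span{ u⁽¹⁾_{m₁} ⋯ u⁽ʳ⁾_{m_r} 1 : 0 ≤ r ≤ n, u⁽ⁱ⁾ ∈ U, mᵢ ∈ ℤ }`. -/
def EU (A : NLVA V) (U : Set V) (n : ℕ) : Submodule ℂ V :=
  Submodule.span ℂ
    {w : V | ∃ rr : ℕ, rr ≤ n ∧ ∃ (u : Fin rr → V) (m : Fin rr → ℤ),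
      (∀ i, u i ∈ U) ∧ w = modeSeqV A rr u m}

theorem EU_mono (A : NLVA V) (U : Set V) : Monotone (EU A U) := by
  intro a b hab
  apply Submodule.span_mono
  rintro w ⟨r, hr, u, m, hu, hw⟩
  exact ⟨r, hr.trans hab, u, m, hu, hw⟩

theorem EU_vac (A : NLVA V) (U : Set V) (n : ℕ) : A.vac ∈ EU A U n :=
  Submodule.subset_span ⟨0, Nat.zero_le _, Fin.elim0, Fin.elim0, fun i => i.elim0, rfl⟩

theorem EU_step (A : NLVA V) (U : Set V) (n : ℕ) (u : V) (hu : u ∈ U) (k : ℤ) (v : V)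
    (hv : v ∈ EU A U n) : A.Y k u v ∈ EU A U (n + 1) := by
  have h : EU A U n ≤ (EU A U (n + 1)).comap (A.Y k u) := by
    apply Submodule.span_le.2
    rintro w ⟨r, hr, u', m, hu', rfl⟩
    refine Submodule.subset_span ⟨r + 1, by omega, Fin.cons u u', Fin.cons k m, ?_, ?_⟩
    · intro i
      refine Fin.cases ?_ ?_ i
      · simpa using hu
      · intro j
        simpa using hu' j
    · simp [modeSeqV]
  exact h hv

/-- Weak associativity moves a product `u_p a` out, by downward induction on `p`. -/
theorem assoc_mem (A : NLVA V) (W : Submodule ℂ V) (u a w : V)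
    (h : ∀ s t : ℤ, A.Y s u (A.Y t a w) ∈ W) (p q : ℤ) :
    A.Y q (A.Y p u a) w ∈ W := by
  obtain ⟨l, hl⟩ := A.weak_assoc u a w
  obtain ⟨N, hN⟩ := A.trunc u a
  have key : ∀ d : ℕ, ∀ p q : ℤ, N - d ≤ p → A.Y q (A.Y p u a) w ∈ W := by
    intro d
    induction d with
    | zero =>
      intro p q hp
      rw [hN p (by simpa using hp)]
      simp
    | succ d ih =>
      intro p q hp
      have e := hl p (q - l)
      rw [Finset.sum_range_succ'] at e
      simp only [Nat.choose_zero_right, Nat.cast_one, one_smul, Nat.cast_zero, add_zero,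
        sub_zero, sub_add_cancel] at e
      rw [← sub_eq_iff_eq_add'] at e
      rw [← e]
      refine W.sub_mem ?_ (W.sum_mem fun i _ => ?_)
      · exact finsum_induction (· ∈ W) W.zero_mem (fun _ _ => W.add_mem)
          (fun j => W.toAddSubgroup.zsmul_mem (h _ _) _)
      · refine W.toAddSubgroup.zsmul_mem (ih _ _ ?_) _
        push_cast at hp ⊢
        omega
  refine key (N - p).toNat p q ?_
  omega

theorem modeSeq_mem (A : NLVA V) (U : Set V) (n : ℕ) (v : V) (hv : v ∈ EU A U n) :
    ∀ (r : ℕ) (u : Fin r → V) (m : Fin r → ℤ), (∀ i, u i ∈ U) → ∀ k : ℤ,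
      A.Y k (modeSeqV A r u m) v ∈ EU A U (r + n) := by
  intro r
  induction r with
  | zero =>
    intro u m _ k
    rw [modeSeqV, A.vacuum_left]
    split_ifs
    · simpa using hv
    · exact Submodule.zero_mem _
  | succ r ih =>
    intro u m hu k
    rw [modeSeqV]
    apply assoc_mem
    intro s t
    have := EU_step A U (r + n) (u 0) (hu 0) s _ (ih (Fin.tail u) (Fin.tail m)
      (fun i => hu i.succ) t)
    rwa [Nat.add_right_comm] at this

/-- Let `V` be a nonlocal vertex algebra and `U` a generating subset (i.e. the only
subspace of `V` containing the vacuum and `U` and closed under all products `uₘ ·` with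
`u ∈ U` is `V` itself).  Then `(Eₙ^U)` is an increasing exhaustive filtration of `V`
satisfying `aₖ Eₙ^U ⊆ E_{m+n}^U` for all `a ∈ Eₘ^U`, `k ∈ ℤ`. -/
theorem stmt6 (A : NLVA V) (U : Set V)
    (hgen : ∀ W : Submodule ℂ V, A.vac ∈ W → U ⊆ W →
      (∀ u ∈ U, ∀ k : ℤ, ∀ v ∈ W, A.Y k u v ∈ W) → W = ⊤) :
    Monotone (EU A U) ∧ (⨆ n, EU A U n) = ⊤ ∧
    ∀ (m n : ℕ) (k : ℤ) (a v : V),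
      a ∈ EU A U m → v ∈ EU A U n → A.Y k a v ∈ EU A U (m + n) := by
  refine ⟨EU_mono A U, ?_, ?_⟩
  · have hdir : Directed (· ≤ ·) (EU A U) := (EU_mono A U).directed_le
    apply hgen
    · exact Submodule.mem_iSup_of_mem 0 (EU_vac A U 0)
    · intro u hu
      have := EU_step A U 0 u hu (-1) _ (EU_vac A U 0)
      rw [A.creation_const] at this
      exact Submodule.mem_iSup_of_mem _ this
    · intro u hu k v hv
      obtain ⟨n, hn⟩ := (Submodule.mem_iSup_of_directed _ hdir).1 hv
      exact Submodule.mem_iSup_of_mem _ (EU_step A U n u hu k v hn)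
  · intro m n k a v ha hv
    have h : EU A U m ≤ (EU A U (m + n)).comap ((A.Y k).flip v) := by
      apply Submodule.span_le.2
      rintro w ⟨r, hr, u, ms, hu, rfl⟩
      exact EU_mono A U (by omega) (modeSeq_mem A U n v hv r u ms hu k)
    exact h ha
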